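/- Let σ̄ : k → k be the unique ℂ-algebra automorphism with σ̄(q) = q⁻¹. The σ̄-semilinear map determined by t_{ij} ↦ t_{N+1−i,N+1−j} and ∂_{ij} ↦ ∂_{N+1−i,N+1−j} (and c ↦ σ̄(c) on scalars) defines a ℂ-algebra isomorphism from 𝒜₀₀ onto 𝒜₁₁, and the same assignment defines a ℂ-algebra isomorphism from 𝒜₀₁ onto 𝒜₁₀. -/

import Mathlib

open scoped BigOperators TensorProduct

noncomputable section

abbrev K : Type := RatFunc ℂ

def q : K := RatFunc.X

/-- The standard R-matrix of `U_q(gl_N)`: the coefficient of `e_{ik} ⊗ e_{jl}` is the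
entry at row `(i,j)`, column `(k,l)`. -/
def Rmat (N : ℕ) : Matrix (Fin N × Fin N) (Fin N × Fin N) K :=
  Matrix.of fun p c =>
    if p.1 = c.1 ∧ p.2 = c.2 then (if p.1 = p.2 then q else 1)
    else if p.1 = c.2 ∧ p.2 = c.1 ∧ c.1 < p.1 then q - q⁻¹
    else 0

/-- partial transpose in the first tensor factor -/
def pt1 {N : ℕ} {α : Type} (C : Matrix (Fin N × Fin N) (Fin N × Fin N) α) :
    Matrix (Fin N × Fin N) (Fin N × Fin N) α :=
  Matrix.of fun p c => C (c.1, p.2) (p.1, c.2)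

/-- partial transpose in the second tensor factor -/
def pt2 {N : ℕ} {α : Type} (C : Matrix (Fin N × Fin N) (Fin N × Fin N) α) :
    Matrix (Fin N × Fin N) (Fin N × Fin N) α :=
  Matrix.of fun p c => C (p.1, c.2) (c.1, p.2)

/-- flip of the two tensor factors -/
def flip21 {N : ℕ} {α : Type} (C : Matrix (Fin N × Fin N) (Fin N × Fin N) α) :
    Matrix (Fin N × Fin N) (Fin N × Fin N) α :=
  Matrix.of fun p c => C (p.2, p.1) (c.2, c.1)

/-- `R₀ = R` and `R₁ = R₂₁⁻¹`. -/
def Rv (N : ℕ) (i : Fin 2) : Matrix (Fin N × Fin N) (Fin N × Fin N) K :=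
  if i = 0 then Rmat N else (flip21 (Rmat N))⁻¹

/-- the generator `t_{ij}` inside the big free algebra -/
def tF {N : ℕ} (i j : Fin N) : FreeAlgebra K ((Fin N × Fin N) ⊕ (Fin N × Fin N)) :=
  FreeAlgebra.ι K (Sum.inl (i, j))

/-- the generator `∂_{ij}` inside the big free algebra -/
def dF {N : ℕ} (i j : Fin N) : FreeAlgebra K ((Fin N × Fin N) ⊕ (Fin N × Fin N)) :=
  FreeAlgebra.ι K (Sum.inr (i, j))

/-- the defining relations of the twisted tensor product algebra `𝒜_{υσ}` -/
inductive ttRel (N : ℕ) (υ σ : Fin 2) :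
    FreeAlgebra K ((Fin N × Fin N) ⊕ (Fin N × Fin N)) →
      FreeAlgebra K ((Fin N × Fin N) ⊕ (Fin N × Fin N)) → Prop
  | trowq (l i j : Fin N) (h : i < j) :
      ttRel N υ σ (tF l i * tF l j) (q • (tF l j * tF l i))
  | tcolq (l i j : Fin N) (h : i < j) :
      ttRel N υ σ (tF i l * tF j l) (q • (tF j l * tF i l))
  | tanti (i k j l : Fin N) (h1 : i < k) (h2 : j < l) :
      ttRel N υ σ (tF i l * tF k j) (tF k j * tF i l)
  | tmain (i k j l : Fin N) (h1 : i < k) (h2 : j < l) :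
      ttRel N υ σ (tF i j * tF k l) (tF k l * tF i j + (q - q⁻¹) • (tF k j * tF i l))
  | drowq (l i j : Fin N) (h : i < j) :
      ttRel N υ σ (dF l j * dF l i) (q • (dF l i * dF l j))
  | dcolq (l i j : Fin N) (h : i < j) :
      ttRel N υ σ (dF j l * dF i l) (q • (dF i l * dF j l))
  | danti (i k j l : Fin N) (h1 : i < k) (h2 : j < l) :
      ttRel N υ σ (dF k j * dF i l) (dF i l * dF k j)
  | dmain (i k j l : Fin N) (h1 : i < k) (h2 : j < l) :
      ttRel N υ σ (dF k l * dF i j) (dF i j * dF k l + (q - q⁻¹) • (dF i l * dF k j))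
  | cross (e a f b : Fin N) :
      ttRel N υ σ (dF e a * tF f b)
        (∑ d : Fin N, ∑ l : Fin N, ∑ j : Fin N, ∑ m : Fin N,
          (pt2 (Rv N σ) (d, l) (f, e) * pt2 (Rv N υ) (j, m) (b, a)) • (tF d j * dF l m))

/-- the twisted tensor product algebra `𝒜_{υσ}` -/
abbrev Att (N : ℕ) (υ σ : Fin 2) := RingQuot (ttRel N υ σ)

/-- the class of `t_{ij}` in `𝒜_{υσ}` -/
def tAtt (N : ℕ) (υ σ : Fin 2) (i j : Fin N) : Att N υ σ :=
  RingQuot.mkAlgHom K (ttRel N υ σ) (tF i j)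

/-- the class of `∂_{ij}` in `𝒜_{υσ}` -/
def dAtt (N : ℕ) (υ σ : Fin 2) (i j : Fin N) : Att N υ σ :=
  RingQuot.mkAlgHom K (ttRel N υ σ) (dF i j)

/-- A ring homomorphism out of a free algebra, determined by central values on scalars and
arbitrary values on generators. -/
theorem exists_freeAlgebra_ringHom {R X B : Type*} [CommRing R] [Ring B] (g : R →+* B)
    (hg : ∀ c x, g c * x = x * g c) (f : X → B) :
    ∃ φ : FreeAlgebra R X →+* B,
      (∀ c, φ (algebraMap R (FreeAlgebra R X) c) = g c) ∧ ∀ x, φ (FreeAlgebra.ι R x) = f x := by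
  let : Algebra R B := g.toAlgebra' hg
  refine ⟨(FreeAlgebra.lift R f : FreeAlgebra R X →ₐ[R] B), fun c => ?_, fun x => ?_⟩
  · exact (FreeAlgebra.lift R f).commutes c
  · exact FreeAlgebra.lift_ι_apply f x

theorem freeAlgebra_ringHom_ext {R X B : Type*} [CommRing R] [Ring B]
    {φ ψ : FreeAlgebra R X →+* B}
    (hs : ∀ c, φ (algebraMap R (FreeAlgebra R X) c) = ψ (algebraMap R (FreeAlgebra R X) c))
    (hι : ∀ x, φ (FreeAlgebra.ι R x) = ψ (FreeAlgebra.ι R x)) : φ = ψ := by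
  ext a
  induction a using FreeAlgebra.induction with
  | grade0 c => exact hs c
  | grade1 x => exact hι x
  | mul a b ha hb => rw [map_mul, map_mul, ha, hb]
  | add a b ha hb => rw [map_add, map_add, ha, hb]

/-- The off-diagonal part of `R₂₁`, up to the factor `q - q⁻¹`. -/
def offDiag (N : ℕ) : Matrix (Fin N × Fin N) (Fin N × Fin N) K :=
  Matrix.of fun p c => if c = p.swap ∧ p.1 < p.2 then 1 else 0

/-- The diagonal part of `R₂₁`, with `q` replaced by `x`. -/
def diagPart (N : ℕ) (x : K) : Matrix (Fin N × Fin N) (Fin N × Fin N) K :=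
  Matrix.diagonal fun p => if p.1 = p.2 then x else 1

theorem diagPart_mul_offDiag (N : ℕ) (x : K) : diagPart N x * offDiag N = offDiag N := by
  ext p c
  rw [diagPart, Matrix.diagonal_mul, offDiag, Matrix.of_apply]
  split_ifs with h1 h2
  · exact absurd h1 h2.2.ne
  · simp
  · simp
  · simp

theorem offDiag_mul_diagPart (N : ℕ) (x : K) : offDiag N * diagPart N x = offDiag N := by
  ext p c
  rw [diagPart, Matrix.mul_diagonal, offDiag, Matrix.of_apply]
  split_ifs with h1 h2
  · rw [h1.1] at h2
    exact absurd h2.symm h1.2.ne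
  · simp
  · simp
  · simp

theorem offDiag_mul_self (N : ℕ) : offDiag N * offDiag N = 0 := by
  ext p c
  rw [Matrix.mul_apply]
  refine Finset.sum_eq_zero fun k _ => ?_
  simp only [offDiag, Matrix.of_apply]
  split_ifs with h1 h2
  · rw [h1.1] at h2
    exact absurd h1.2 h2.2.asymm
  · simp
  · simp
  · simp

theorem diagPart_mul_diagPart_inv (N : ℕ) {x : K} (hx : x ≠ 0) :
    diagPart N x * diagPart N x⁻¹ = 1 := by
  rw [diagPart, diagPart, Matrix.diagonal_mul_diagonal, ← Matrix.diagonal_one]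
  congr 1
  ext p
  split_ifs <;> simp [hx]

theorem q_ne_zero : q ≠ 0 := RatFunc.X_ne_zero

theorem flip21_Rmat (N : ℕ) :
    flip21 (Rmat N) = diagPart N q + (q - q⁻¹) • offDiag N := by
  ext ⟨a, b⟩ ⟨c, d⟩
  simp only [flip21, Rmat, diagPart, offDiag, Matrix.of_apply, Matrix.add_apply,
    Matrix.smul_apply, Matrix.diagonal_apply, Prod.mk.injEq, Prod.swap_prod_mk, smul_eq_mul]
  grind

theorem Rv_one (N : ℕ) : Rv N 1 = diagPart N q⁻¹ + (q⁻¹ - q) • offDiag N := by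
  rw [Rv, if_neg (by decide), flip21_Rmat]
  refine Matrix.inv_eq_right_inv ?_
  rw [add_mul, mul_add, mul_add, diagPart_mul_diagPart_inv N q_ne_zero, Matrix.mul_smul,
    diagPart_mul_offDiag, Matrix.smul_mul, offDiag_mul_diagPart, Matrix.smul_mul,
    Matrix.mul_smul, offDiag_mul_self, smul_zero, smul_zero, add_zero, add_assoc, ← add_smul]
  simp

theorem Rv_one_apply_eq (N : ℕ) (τ : K ≃+* K) (hτ : τ q = q⁻¹) (a b c d : Fin N) :
    Rv N 1 (a.rev, b.rev) (c.rev, d.rev) = τ (Rv N 0 (a, b) (c, d)) := by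
  rw [Rv_one, Rv, if_pos rfl]
  have h0 : τ (q - q⁻¹) = q⁻¹ - q := by rw [map_sub, map_inv₀, hτ, inv_inv]
  simp only [Rmat, diagPart, offDiag, Matrix.of_apply, Matrix.add_apply,
    Matrix.smul_apply, Matrix.diagonal_apply, Prod.mk.injEq, Prod.swap_prod_mk, smul_eq_mul,
    Fin.rev_inj, Fin.rev_lt_rev, apply_ite τ, hτ, h0, map_one, map_zero]
  grind

theorem Rv_apply_rev (N : ℕ) (τ : K ≃+* K) (hτ : τ q = q⁻¹) (u : Fin 2) (a b c d : Fin N) :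
    Rv N u.rev (a.rev, b.rev) (c.rev, d.rev) = τ (Rv N u (a, b) (c, d)) := by
  have hτ' : τ.symm q = q⁻¹ := by
    rw [RingEquiv.symm_apply_eq, map_inv₀, hτ, inv_inv]
  match u with
  | 0 => exact Rv_one_apply_eq N τ hτ a b c d
  | 1 =>
    have h := Rv_one_apply_eq N τ.symm hτ' a.rev b.rev c.rev d.rev
    simp only [Fin.rev_rev] at h
    rw [h, RingEquiv.apply_symm_apply]
    rfl

theorem exists_att_ringHom (N : ℕ) (τ : K ≃+* K) (hτ : τ q = q⁻¹) (u s : Fin 2) :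
    ∃ φ : Att N u s →+* Att N u.rev s.rev,
      (∀ c : K, φ (algebraMap K (Att N u s) c) = algebraMap K (Att N u.rev s.rev) (τ c)) ∧
      (∀ i j : Fin N, φ (tAtt N u s i j) = tAtt N u.rev s.rev i.rev j.rev) ∧
      (∀ i j : Fin N, φ (dAtt N u s i j) = dAtt N u.rev s.rev i.rev j.rev) := by
  obtain ⟨φ, hs, hι⟩ := exists_freeAlgebra_ringHom
    (X := (Fin N × Fin N) ⊕ (Fin N × Fin N))
    ((algebraMap K (Att N u.rev s.rev)).comp (τ : K →+* K))
    (fun c x => Algebra.commutes (τ c) x)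
    (Sum.elim (fun p => tAtt N u.rev s.rev p.1.rev p.2.rev)
      (fun p => dAtt N u.rev s.rev p.1.rev p.2.rev))
  have ht (i j : Fin N) : φ (tF i j) = tAtt N u.rev s.rev i.rev j.rev := hι (Sum.inl (i, j))
  have hd (i j : Fin N) : φ (dF i j) = dAtt N u.rev s.rev i.rev j.rev := hι (Sum.inr (i, j))
  have hsmul (c : K) (x) : φ (c • x) = τ c • φ x := by
    rw [Algebra.smul_def, Algebra.smul_def, map_mul, hs]
    rfl
  have hq : τ (q - q⁻¹) = -(q - q⁻¹) := by rw [map_sub, map_inv₀, hτ, inv_inv, neg_sub]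
  have rel {x y} (h : ttRel N u.rev s.rev x y) :
      RingQuot.mkAlgHom K (ttRel N u.rev s.rev) x = RingQuot.mkAlgHom K _ y :=
    RingQuot.mkAlgHom_rel K h
  have hrel : ∀ ⦃x y⦄, ttRel N u s x y → φ x = φ y := by
    intro x y h
    cases h with
    | trowq l i j h =>
      have := rel (.trowq l.rev j.rev i.rev (Fin.rev_lt_rev.2 h))
      simp only [map_mul, map_smul] at this
      simp only [hsmul, map_mul, ht, hτ, tAtt]
      rw [this, inv_smul_smul₀ q_ne_zero]
    | tcolq l i j h =>
      have := rel (.tcolq l.rev j.rev i.rev (Fin.rev_lt_rev.2 h))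
      simp only [map_mul, map_smul] at this
      simp only [hsmul, map_mul, ht, hτ, tAtt]
      rw [this, inv_smul_smul₀ q_ne_zero]
    | tanti i k j l h1 h2 =>
      have := rel (.tanti k.rev i.rev l.rev j.rev (Fin.rev_lt_rev.2 h1) (Fin.rev_lt_rev.2 h2))
      simp only [map_mul] at this
      simp only [map_mul, ht, tAtt]
      exact this.symm
    | tmain i k j l h1 h2 =>
      have h3 := rel (.tanti k.rev i.rev l.rev j.rev (Fin.rev_lt_rev.2 h1) (Fin.rev_lt_rev.2 h2))
      have := rel (.tmain k.rev i.rev l.rev j.rev (Fin.rev_lt_rev.2 h1) (Fin.rev_lt_rev.2 h2))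
      simp only [map_mul, map_smul, map_add] at this h3
      simp only [map_mul, map_add, hsmul, ht, tAtt, hq]
      rw [this, h3, add_assoc, ← add_smul, add_neg_cancel, zero_smul, add_zero]
    | drowq l i j h =>
      have := rel (.drowq l.rev j.rev i.rev (Fin.rev_lt_rev.2 h))
      simp only [map_mul, map_smul] at this
      simp only [hsmul, map_mul, hd, hτ, dAtt]
      rw [this, inv_smul_smul₀ q_ne_zero]
    | dcolq l i j h =>
      have := rel (.dcolq l.rev j.rev i.rev (Fin.rev_lt_rev.2 h))
      simp only [map_mul, map_smul] at this
      simp only [hsmul, map_mul, hd, hτ, dAtt]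
      rw [this, inv_smul_smul₀ q_ne_zero]
    | danti i k j l h1 h2 =>
      have := rel (.danti k.rev i.rev l.rev j.rev (Fin.rev_lt_rev.2 h1) (Fin.rev_lt_rev.2 h2))
      simp only [map_mul] at this
      simp only [map_mul, hd, dAtt]
      exact this.symm
    | dmain i k j l h1 h2 =>
      have h3 := rel (.danti k.rev i.rev l.rev j.rev (Fin.rev_lt_rev.2 h1) (Fin.rev_lt_rev.2 h2))
      have := rel (.dmain k.rev i.rev l.rev j.rev (Fin.rev_lt_rev.2 h1) (Fin.rev_lt_rev.2 h2))
      simp only [map_mul, map_smul, map_add] at this h3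
      simp only [map_mul, map_add, hsmul, hd, dAtt, hq]
      rw [this, h3, add_assoc, ← add_smul, add_neg_cancel, zero_smul, add_zero]
    | cross e a f b =>
      have := rel (.cross e.rev a.rev f.rev b.rev)
      simp only [map_mul, map_smul, map_sum] at this
      simp only [map_mul, map_sum, hsmul, hd, ht]
      rw [dAtt, tAtt, this]
      refine (Fintype.sum_equiv Fin.revPerm _ _ fun d => ?_).symm
      refine Fintype.sum_equiv Fin.revPerm _ _ fun l => ?_
      refine Fintype.sum_equiv Fin.revPerm _ _ fun j => ?_
      refine Fintype.sum_equiv Fin.revPerm _ _ fun m => ?_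
      simp only [pt2, Matrix.of_apply, Fin.revPerm_apply, Rv_apply_rev N τ hτ, tAtt, dAtt]
  have hlift (x) : RingQuot.lift ⟨φ, hrel⟩ (RingQuot.mkAlgHom K (ttRel N u s) x) = φ x := by
    rw [← RingQuot.lift_mkRingHom_apply φ hrel x, ← RingQuot.mkAlgHom_coe K]
    rfl
  refine ⟨RingQuot.lift ⟨φ, hrel⟩, fun c => ?_, fun i j => ?_, fun i j => ?_⟩
  · rw [← (RingQuot.mkAlgHom K (ttRel N u s)).commutes c, hlift, hs]
    rfl
  · rw [tAtt, hlift, ht]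
  · rw [dAtt, hlift, hd]

theorem att_ringHom_ext {N : ℕ} {u s : Fin 2} {B : Type*} [Ring B] {φ ψ : Att N u s →+* B}
    (hs : ∀ c : K, φ (algebraMap K _ c) = ψ (algebraMap K _ c))
    (ht : ∀ i j, φ (tAtt N u s i j) = ψ (tAtt N u s i j))
    (hd : ∀ i j, φ (dAtt N u s i j) = ψ (dAtt N u s i j)) : φ = ψ := by
  refine RingQuot.ringQuot_ext φ ψ ?_
  rw [← RingQuot.mkAlgHom_coe K]
  refine freeAlgebra_ringHom_ext (fun c => ?_) (fun x => ?_)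
  · have h := (RingQuot.mkAlgHom K (ttRel N u s)).commutes c
    simp only [RingHom.comp_apply, RingHom.coe_coe, h, hs]
  · rcases x with ⟨i, j⟩ | ⟨i, j⟩
    · exact ht i j
    · exact hd i j

theorem exists_att_ringEquiv (N : ℕ) (τ : K ≃+* K) (hτ : τ q = q⁻¹) (u s : Fin 2) :
    ∃ Φ : Att N u s ≃+* Att N u.rev s.rev,
      (∀ c : K, Φ (algebraMap K (Att N u s) c) = algebraMap K (Att N u.rev s.rev) (τ c)) ∧
      (∀ i j : Fin N, Φ (tAtt N u s i j) = tAtt N u.rev s.rev i.rev j.rev) ∧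
      (∀ i j : Fin N, Φ (dAtt N u s i j) = dAtt N u.rev s.rev i.rev j.rev) := by
  have hτ' : τ.symm q = q⁻¹ := by
    rw [RingEquiv.symm_apply_eq, map_inv₀, hτ, inv_inv]
  obtain ⟨φ, hs, ht, hd⟩ := exists_att_ringHom N τ hτ u s
  obtain ⟨ψ, hs', ht', hd'⟩ : ∃ ψ : Att N u.rev s.rev →+* Att N u s,
      (∀ c : K, ψ (algebraMap K (Att N u.rev s.rev) c) = algebraMap K (Att N u s) (τ.symm c)) ∧
      (∀ i j : Fin N, ψ (tAtt N u.rev s.rev i j) = tAtt N u s i.rev j.rev) ∧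
      (∀ i j : Fin N, ψ (dAtt N u.rev s.rev i j) = dAtt N u s i.rev j.rev) := by
    have h := exists_att_ringHom N τ.symm hτ' u.rev s.rev
    rwa [Fin.rev_rev, Fin.rev_rev] at h
  refine ⟨RingEquiv.ofRingHom φ ψ (att_ringHom_ext ?_ ?_ ?_) (att_ringHom_ext ?_ ?_ ?_),
    hs, ht, hd⟩ <;> intros <;> simp [hs, ht, hd, hs', ht', hd']

theorem stmt14 (N : ℕ) (hN : 1 ≤ N) (σb : K ≃+* K)
    (hσC : ∀ c : ℂ, σb (RatFunc.C c) = RatFunc.C c) (hσq : σb q = q⁻¹) :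
    (∃ Φ : Att N 0 0 ≃+* Att N 1 1,
      (∀ c : K, Φ (algebraMap K (Att N 0 0) c) = algebraMap K (Att N 1 1) (σb c)) ∧
      (∀ i j : Fin N, Φ (tAtt N 0 0 i j) = tAtt N 1 1 i.rev j.rev) ∧
      (∀ i j : Fin N, Φ (dAtt N 0 0 i j) = dAtt N 1 1 i.rev j.rev)) ∧
    (∃ Φ : Att N 0 1 ≃+* Att N 1 0,
      (∀ c : K, Φ (algebraMap K (Att N 0 1) c) = algebraMap K (Att N 1 0) (σb c)) ∧
      (∀ i j : Fin N, Φ (tAtt N 0 1 i j) = tAtt N 1 0 i.rev j.rev) ∧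
      (∀ i j : Fin N, Φ (dAtt N 0 1 i j) = dAtt N 1 0 i.rev j.rev)) := by
  exact ⟨exists_att_ringEquiv N σb hσq 0 0, exists_att_ringEquiv N σb hσq 0 1⟩
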